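/- arXiv:0708.1989 — 2 statements merged into one kernel-verified Lean document; each statement's English description precedes it below -/
import Mathlib

section
/- Let P : ℝ → M_n(ℂ) be a differentiable family of matrices with P(t)² = P(t) for all t, and let Q : ℝ → M_n(ℂ) be a differentiable family satisfying the linear differential equation Q′(t) = [P′(t), P(t)]·Q(t) with initial condition Q(0) = 1, where [A,B] = AB − BA. Then P(t)·Q(t) = Q(t)·P(0) for all t; i.e., Q(t) intertwines the projection P(0) with the projection P(t). -/
open scoped Matrix

namespace Matrix
variable {ι : Type*} [Fintype ι]

open scoped Norms.Operator in
theorem hasDerivAt_of_hasDerivAt_apply {M : ℝ → Matrix ι ι ℂ} {M' : Matrix ι ι ℂ} {t : ℝ}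
    (h : ∀ i j, HasDerivAt (fun s => M s i j) (M' i j) t) : HasDerivAt M M' t :=
  hasDerivAt_pi.2 fun i => hasDerivAt_pi.2 fun j => h i j

variable [DecidableEq ι]

/-- Liouville's formula for the determinant of a solution of `Q' = A Q`. -/
theorem hasDerivAt_det_of_hasDerivAt_mul {Q : ℝ → Matrix ι ι ℂ} {A : Matrix ι ι ℂ} {t : ℝ}
    (h : ∀ i j, HasDerivAt (fun s => Q s i j) ((A * Q t) i j) t) :
    HasDerivAt (fun s => (Q s).det) (A.trace * (Q t).det) t := by
  have hdet (M : Matrix ι ι ℂ) :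
      M.det = ∑ σ : Equiv.Perm ι, (Equiv.Perm.sign σ : ℂ) * ∏ i, M i (σ i) := by
    rw [← det_transpose, det_apply']; rfl
  have hprod (σ : Equiv.Perm ι) := HasDerivAt.fun_finsetProd (u := Finset.univ)
    fun i _ => h i (σ i)
  have hsum : ∑ i, ((Q t).updateRow i ((A * Q t) i)).det = A.trace * (Q t).det := by
    rw [trace, Finset.sum_mul]
    refine Finset.sum_congr rfl fun i _ => ?_
    rw [diag_apply, ← smul_eq_mul (A i i), ← det_updateRow_sum]
    congr 2
    ext j
    simp [mul_apply]
  rw [← hsum]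
  simp_rw [hdet]
  refine (HasDerivAt.fun_sum fun σ _ => (hprod σ).const_mul _).congr_deriv ?_
  rw [Finset.sum_comm]
  refine Finset.sum_congr rfl fun σ _ => ?_
  rw [Finset.mul_sum]
  refine Finset.sum_congr rfl fun i hi => ?_
  rw [← Finset.prod_erase_mul _ _ hi, smul_eq_mul, updateRow_self]
  congr 2
  refine Finset.prod_congr rfl fun k hk => ?_
  rw [updateRow_ne (Finset.ne_of_mem_erase hk)]

theorem det_eq_of_trace_eq_zero {Q A : ℝ → Matrix ι ι ℂ} (hA : ∀ t, (A t).trace = 0)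
    (h : ∀ t i j, HasDerivAt (fun s => Q s i j) ((A t * Q t) i j) t) (s t : ℝ) :
    (Q s).det = (Q t).det := by
  have hd (t : ℝ) : HasDerivAt (fun s => (Q s).det) 0 t := by
    simpa [hA t] using hasDerivAt_det_of_hasDerivAt_mul (h t)
  exact is_const_of_deriv_eq_zero (fun t => (hd t).differentiableAt) (fun t => (hd t).deriv) s t

end Matrix

theorem HasDerivAt.isIdempotentElem_mul_add {R : Type*} [NormedRing R] [NormedAlgebra ℝ R]
    {P : ℝ → R} {P' : R} {t : ℝ} (hP : HasDerivAt P P' t) (h : ∀ t, P t * P t = P t) :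
    P' * P t + P t * P' = P' := by
  have h2 := hP.mul hP
  have : P * P = P := funext h
  rw [this] at h2
  exact h2.unique hP

theorem IsIdempotentElem.commutator_commutator {R : Type*} [Ring R] {p d : R}
    (hp : p * p = p) (hd : d * p + p * d = d) :
    (d * p - p * d) * p - p * (d * p - p * d) = d := by
  have h : p * d * p = 0 := by
    have h1 := congrArg (p * ·) hd
    simp only [mul_add, ← mul_assoc, hp] at h1
    simpa using h1
  have h2 : d * p * p = d * p := by rw [mul_assoc, hp]
  simp only [sub_mul, mul_sub, ← mul_assoc, hp, h, h2]
  simpa using hd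

/-- If `Q' = A Q` with `Q` invertible and `P' = [A, P]`, then `Q⁻¹ P Q` is constant. -/
theorem inverse_mul_mul_eq_of_hasDerivAt {R : Type*} [NormedRing R] [NormedAlgebra ℝ R]
    [CompleteSpace R] {P P' Q A : ℝ → R} (hQ : ∀ t, HasDerivAt Q (A t * Q t) t) (hu : ∀ t, IsUnit (Q t))
    (hP : ∀ t, HasDerivAt P (P' t) t) (h : ∀ t, A t * P t - P t * A t = P' t) (s t : ℝ) :
    Ring.inverse (Q s) * P s * Q s = Ring.inverse (Q t) * P t * Q t := by
  have hd (t : ℝ) : HasDerivAt (fun s => Ring.inverse (Q s) * P s * Q s) 0 t := by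
    obtain ⟨u, hu⟩ := hu t
    have hi := (hu ▸ hasFDerivAt_ringInverse (𝕜 := ℝ) u :
      HasFDerivAt _ _ (Q t)).comp_hasDerivAt t (hQ t)
    refine ((hi.mul (hP t)).mul (hQ t)).congr_deriv ?_
    simp [← hu, ← h t]
    noncomm_ring
    simp
  exact is_const_of_deriv_eq_zero (fun t => (hd t).differentiableAt) (fun t => (hd t).deriv) s t

open scoped Matrix.Norms.Operator in
/-- The transport equation intertwines projections, for an arbitrary finite index type. -/
theorem Matrix.mul_eq_mul_of_hasDerivAt_commutator {ι : Type*} [Fintype ι] [DecidableEq ι]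
    (P P' Q : ℝ → Matrix ι ι ℂ)
    (hPderiv : ∀ t i j, HasDerivAt (fun s => P s i j) (P' t i j) t)
    (hproj : ∀ t, P t * P t = P t)
    (hQderiv : ∀ t i j,
      HasDerivAt (fun s => Q s i j) (((P' t * P t - P t * P' t) * Q t) i j) t)
    (hQ0 : Q 0 = 1) (t : ℝ) :
    P t * Q t = Q t * P 0 := by
  have hP t := Matrix.hasDerivAt_of_hasDerivAt_apply (hPderiv t)
  have hQ t := Matrix.hasDerivAt_of_hasDerivAt_apply (hQderiv t)
  have hdet (t : ℝ) : IsUnit (Q t) := by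
    rw [Matrix.isUnit_iff_isUnit_det, Matrix.det_eq_of_trace_eq_zero (fun t => by
      rw [Matrix.trace_sub, Matrix.trace_mul_comm, sub_self]) hQderiv t 0, hQ0]
    simp
  have := inverse_mul_mul_eq_of_hasDerivAt hQ hdet hP (fun t =>
    IsIdempotentElem.commutator_commutator (hproj t) ((hP t).isIdempotentElem_mul_add hproj)) t 0
  simp only [hQ0, Ring.inverse_one, one_mul, mul_one] at this
  rw [← this, ← mul_assoc, ← mul_assoc, Ring.mul_inverse_cancel _ (hdet t), one_mul]

/-- Let `P : ℝ → M_n(ℂ)` be a differentiable family of projections (`P(t)² = P(t)`),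
and let `Q : ℝ → M_n(ℂ)` be a differentiable family solving
`Q'(t) = [P'(t), P(t)] Q(t)` with `Q(0) = 1`, where `[A, B] = A B - B A` and derivatives
are entrywise. Then `P(t) Q(t) = Q(t) P(0)` for all `t`: the transport operator `Q(t)`
intertwines the projection `P(0)` with the projection `P(t)`. -/
theorem transport_intertwines_projections
    (n : ℕ) (hn : 1 ≤ n) (P P' Q : ℝ → Matrix (Fin n) (Fin n) ℂ)
    (hPderiv : ∀ t i j, HasDerivAt (fun s => P s i j) (P' t i j) t)
    (hproj : ∀ t, P t * P t = P t)
    (hQderiv : ∀ t i j,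
      HasDerivAt (fun s => Q s i j) (((P' t * P t - P t * P' t) * Q t) i j) t)
    (hQ0 : Q 0 = 1) (t : ℝ) :
    P t * Q t = Q t * P 0 := by
  exact Matrix.mul_eq_mul_of_hasDerivAt_commutator P P' Q hPderiv hproj hQderiv hQ0 t
end

section
/- Let P : ℝ → M_n(ℂ) be a differentiable family of matrices with P(t)² = P(t) and P(t)† = P(t) for all t (a differentiable family of Hermitian projections), and let Q : ℝ → M_n(ℂ) be differentiable with Q′(t) = [P′(t), P(t)]·Q(t) and Q(0) = 1, where [A,B] = AB − BA. Then Q(t) is unitary for every t, i.e., Q(t)†·Q(t) = 1. -/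
open scoped Matrix

theorem Matrix.hasDerivAt_conjTranspose_mul_self_apply {m n : Type*} [Fintype m]
    {Q : ℝ → Matrix m n ℂ} {Q' : Matrix m n ℂ} {t : ℝ}
    (hQ : ∀ i j, HasDerivAt (fun s => Q s i j) (Q' i j) t) (i j : n) :
    HasDerivAt (fun s => ((Q s)ᴴ * Q s) i j) ((Q'ᴴ * Q t + (Q t)ᴴ * Q') i j) t := by
  simp only [Matrix.add_apply, Matrix.mul_apply, Matrix.conjTranspose_apply,
    ← Finset.sum_add_distrib]
  exact HasDerivAt.fun_sum fun k _ => (hQ k i).star.mul (hQ k j)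

/-- The flow of a skew-Hermitian generator preserves `Qᴴ * Q`. -/
theorem Matrix.conjTranspose_mul_self_eq_of_skewHermitian {m n : Type*} [Fintype m]
    {A : ℝ → Matrix m m ℂ} {Q : ℝ → Matrix m n ℂ} (hA : ∀ t, (A t)ᴴ = -A t)
    (hQ : ∀ t i j, HasDerivAt (fun s => Q s i j) ((A t * Q t) i j) t) (s t : ℝ) :
    (Q s)ᴴ * Q s = (Q t)ᴴ * Q t := by
  ext i j
  have hderiv (u : ℝ) : HasDerivAt (fun s => ((Q s)ᴴ * Q s) i j) 0 u := by
    convert Matrix.hasDerivAt_conjTranspose_mul_self_apply (hQ u) i j using 1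
    simp [Matrix.conjTranspose_mul, hA, Matrix.mul_assoc]
  exact is_const_of_deriv_eq_zero (fun u => (hderiv u).differentiableAt)
    (fun u => (hderiv u).deriv) s t

theorem Matrix.conjTranspose_deriv_eq_of_isHermitian {n : Type*}
    {P : ℝ → Matrix n n ℂ} {P' : Matrix n n ℂ} {t : ℝ} (hP : ∀ s, (P s)ᴴ = P s)
    (hP' : ∀ i j, HasDerivAt (fun s => P s i j) (P' i j) t) : P'ᴴ = P' := by
  ext i j
  have hstar : (fun s => star (P s j i)) = fun s => P s i j :=
    funext fun s => congrFun₂ (hP s) i j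
  exact (hstar ▸ (hP' j i).star).unique (hP' i j)

/-- Let `P : ℝ → M_n(ℂ)` be a differentiable family of Hermitian projections
(`P(t)² = P(t)` and `P(t)† = P(t)`), and let `Q : ℝ → M_n(ℂ)` be a differentiable family
solving `Q'(t) = [P'(t), P(t)] Q(t)` with `Q(0) = 1`, where `[A, B] = A B - B A` and
derivatives are entrywise. Then `Q(t)` is unitary for every `t`: `Q(t)† Q(t) = 1`. -/
theorem transport_is_unitary
    (n : ℕ) (hn : 1 ≤ n) (P P' Q : ℝ → Matrix (Fin n) (Fin n) ℂ)
    (hPderiv : ∀ t i j, HasDerivAt (fun s => P s i j) (P' t i j) t)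
    (hproj : ∀ t, P t * P t = P t)
    (hherm : ∀ t, (P t)ᴴ = P t)
    (hQderiv : ∀ t i j,
      HasDerivAt (fun s => Q s i j) (((P' t * P t - P t * P' t) * Q t) i j) t)
    (hQ0 : Q 0 = 1) (t : ℝ) :
    (Q t)ᴴ * Q t = 1 := by
  have hA (u : ℝ) : (P' u * P u - P u * P' u)ᴴ = -(P' u * P u - P u * P' u) := by
    simp [Matrix.conjTranspose_mul, hherm,
      Matrix.conjTranspose_deriv_eq_of_isHermitian hherm (hPderiv u)]
  simpa [hQ0] using Matrix.conjTranspose_mul_self_eq_of_skewHermitian hA hQderiv t 0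
end
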